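/- Let F be a totally real number field of degree d with real embeddings σ₁,…,σ_d : F → ℝ, ring of integers O_F and unit group O_F^×. Fix points z₁,…,z_d in the upper half-plane ℍ and positive integers k₁,…,k_d. Then the family, indexed by pairs (ε, α) ∈ O_F^× × O_F, with value ∏_{j=1}^{d} cosh( d_ℍ( z_j , σ_j(ε)²·z_j + σ_j(ε)·σ_j(α) ) / 2 )^{−2k_j}, is summable. -/

import Mathlib

open NumberField Real UpperHalfPlane

/-- A finite product of copies of a nonnegative summable function is summable. -/
theorem summable_fin_prod_of_nonneg {X : Type*} {G : X → ℝ} (hG : Summable G)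
    (hG0 : ∀ x, 0 ≤ G x) (d : ℕ) : Summable fun f : Fin d → X => ∏ j, G (f j) := by
  induction d with
  | zero => exact Summable.of_finite
  | succ d ih =>
    rw [← (Fin.consEquiv fun _ : Fin (d + 1) => X).summable_iff]
    refine (hG.mul_of_nonneg ih hG0 fun f => Finset.prod_nonneg fun j _ => hG0 _).congr ?_
    intro p
    simp [Fin.prod_univ_succ, Fin.consEquiv]

theorem summable_int_one_add_abs_rpow {p : ℝ} (hp : 1 < p) :
    Summable fun n : ℤ => (1 + |(n : ℝ)|) ^ (-p) := by
  have h : Summable fun n : ℕ => (1 + |(n : ℝ)|) ^ (-p) := by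
    refine ((Real.summable_one_div_nat_add_rpow 1 p).2 hp).congr fun n => ?_
    rw [abs_of_nonneg (by positivity : (0 : ℝ) ≤ n), abs_of_nonneg (by positivity),
      Real.rpow_neg (by positivity), one_div, add_comm]
  rw [summable_int_iff_summable_nat_and_neg]
  exact ⟨by simpa using h, by simpa using h⟩

theorem cosh_half_dist_sq_of_coe_eq {z w : ℍ} {e a : ℝ} (he : e ≠ 0)
    (hw : (w : ℂ) = (e : ℂ) ^ 2 * (z : ℂ) + (e : ℂ) * (a : ℂ)) :
    Real.cosh (dist z w / 2) ^ 2 =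
      ((a - z.re * (e⁻¹ - e)) ^ 2 + z.im ^ 2 * (e + e⁻¹) ^ 2) / (4 * z.im ^ 2) := by
  have hre : w.re = e ^ 2 * z.re + e * a := by
    have := congrArg Complex.re hw
    simpa [pow_two] using this
  have him : w.im = e ^ 2 * z.im := by
    have := congrArg Complex.im hw
    simpa [pow_two] using this
  have hz := z.im_pos
  have h2 : Real.cosh (dist z w) = 2 * Real.cosh (dist z w / 2) ^ 2 - 1 := by
    have h := Real.cosh_two_mul (dist z w / 2)
    rw [mul_div_cancel₀ _ two_ne_zero, Real.sinh_sq] at h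
    linarith
  have h3 := UpperHalfPlane.cosh_dist' z w
  have h4 : Real.cosh (dist z w / 2) ^ 2 = (1 + Real.cosh (dist z w)) / 2 := by linarith
  rw [h4, h3, hre, him]
  field_simp
  ring

theorem one_add_abs_floor_le (x : ℝ) : 1 + |(⌊x⌋ : ℝ)| ≤ 2 + |x| := by
  have h1 := Int.floor_le x
  have h2 := Int.lt_floor_add_one x
  have : |(⌊x⌋ : ℝ)| ≤ |x| + 1 := by
    rw [abs_le]
    constructor <;> cases abs_cases x <;> linarith
  linarith

theorem exists_inv_quadratic_le {y : ℝ} (hy : 0 < y) :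
    ∃ C : ℝ, ∀ e u : ℝ, e ≠ 0 →
      ((u ^ 2 + y ^ 2 * (e + e⁻¹) ^ 2) / (4 * y ^ 2))⁻¹ ≤
        C * (|e| ^ (3 / 4 : ℝ) *
          ((1 + |(⌊e⌋ : ℝ)|) ^ (-(3 / 2) : ℝ) * (1 + |(⌊u⌋ : ℝ)|) ^ (-(5 / 4) : ℝ))) := by
  obtain ⟨c, hc, hc1, hc2⟩ : ∃ c : ℝ, 0 < c ∧ c * (8 * y ^ 2) ≤ 1 ∧ c * 8 ≤ 1 := by
    refine ⟨1 / (8 * (y ^ 2 + 1)), by positivity, ?_, ?_⟩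
    · rw [div_mul_eq_mul_div, div_le_one (by positivity)]; nlinarith
    · rw [div_mul_eq_mul_div, div_le_one (by positivity)]; nlinarith [sq_nonneg y]
  refine ⟨(c ^ (5 / 8 : ℝ) * (c / 64) ^ (3 / 8 : ℝ))⁻¹, fun e u he => ?_⟩
  set A := (u ^ 2 + y ^ 2 * (e + e⁻¹) ^ 2) / (4 * y ^ 2) with hA
  set s := (e + e⁻¹) ^ 2 with hs
  set v := 1 + |(⌊u⌋ : ℝ)| with hv
  set m := 1 + |(⌊e⌋ : ℝ)| with hm
  have he0 : 0 < |e| := abs_pos.2 he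
  have hse : s * |e| ^ 2 = (1 + e ^ 2) ^ 2 := by
    rw [hs, sq_abs]; field_simp; ring
  have hs4 : 4 ≤ s := by
    refine le_of_mul_le_mul_right ?_ (pow_pos he0 2)
    rw [hse, sq_abs]; nlinarith [sq_nonneg (1 - e ^ 2)]
  have hv0 : 0 < v := by positivity
  have hm0 : 0 < m := by positivity
  have hv2 : v ^ 2 ≤ 2 * u ^ 2 + 2 * s := by
    have h := one_add_abs_floor_le u
    have : v ^ 2 ≤ (2 + |u|) ^ 2 := pow_le_pow_left₀ hv0.le h 2
    nlinarith [sq_abs u, sq_nonneg (|u| - 2)]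
  have hm2 : m ^ 2 ≤ 8 * (1 + e ^ 2) := by
    have h := one_add_abs_floor_le e
    have : m ^ 2 ≤ (2 + |e|) ^ 2 := pow_le_pow_left₀ hm0.le h 2
    nlinarith [sq_abs e, sq_nonneg (|e| - 2)]
  have hAs : c * (2 * u ^ 2 + 2 * s) ≤ A := by
    rw [hA, le_div_iff₀ (by positivity)]
    have h1 := mul_le_mul_of_nonneg_right hc1 (sq_nonneg u)
    have h2 := mul_le_mul_of_nonneg_right hc2 (by positivity : 0 ≤ y ^ 2 * s)
    linarith
  have hA1 : c * v ^ 2 ≤ A := (mul_le_mul_of_nonneg_left hv2 hc.le).trans hAs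
  have hA2 : c / 64 * (m ^ 4 / |e| ^ 2) ≤ A := by
    refine le_trans ?_ hAs
    have h1 : m ^ 4 / |e| ^ 2 ≤ 64 * s := by
      rw [div_le_iff₀ (by positivity), mul_assoc, hse]
      nlinarith [pow_le_pow_left₀ (by positivity) hm2 2]
    have h2 := mul_le_mul_of_nonneg_left h1 (by positivity : 0 ≤ c / 64)
    nlinarith [mul_nonneg hc.le (sq_nonneg u), mul_nonneg hc.le (by linarith : 0 ≤ s)]
  have hApos : 0 < A := lt_of_lt_of_le (by positivity) hA1
  have key : (c * v ^ 2) ^ (5 / 8 : ℝ) * (c / 64 * (m ^ 4 / |e| ^ 2)) ^ (3 / 8 : ℝ) ≤ A := by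
    calc _ ≤ A ^ (5 / 8 : ℝ) * A ^ (3 / 8 : ℝ) := by gcongr
      _ = A := by rw [← Real.rpow_add hApos]; norm_num
  refine (inv_anti₀ (by positivity) key).trans (le_of_eq ?_)
  rw [Real.mul_rpow hc.le (by positivity),
    Real.mul_rpow (x := c / 64) (by positivity) (by positivity),
    Real.div_rpow (x := m ^ 4) (by positivity) (by positivity), ← Real.rpow_natCast v, ← Real.rpow_natCast m,
    ← Real.rpow_natCast |e|, ← Real.rpow_mul hv0.le, ← Real.rpow_mul hm0.le,
    ← Real.rpow_mul he0.le, Real.rpow_neg hv0.le, Real.rpow_neg hm0.le]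
  norm_num
  ring

section Embeddings

variable {F : Type*} [Field F] [NumberField F] {d : ℕ} {σ : Fin d → (F →+* ℝ)}

theorem prod_abs_realEmbeddings_eq_abs_norm (hd : d = Module.finrank ℚ F)
    (hσ : Function.Injective σ) (x : F) :
    ∏ j, |σ j x| = |((Algebra.norm ℚ x : ℚ) : ℝ)| := by
  let τ : Fin d → (F →ₐ[ℚ] ℂ) := fun j => (Complex.ofRealHom.comp (σ j)).toRatAlgHom
  have hτ : Function.Bijective τ := by
    rw [Fintype.bijective_iff_injective_and_card]
    refine ⟨fun i j hij => hσ (RingHom.ext fun y => ?_), ?_⟩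
    · have := DFunLike.congr_fun hij y
      simpa [τ] using this
    · rw [Fintype.card_fin, AlgHom.card, hd]
  have h := Algebra.norm_eq_prod_embeddings ℚ ℂ x
  rw [← hτ.prod_comp] at h
  have h' := congrArg norm h
  simp only [norm_prod] at h'
  simpa [τ] using h'.symm

theorem one_le_prod_abs_realEmbeddings (hd : d = Module.finrank ℚ F)
    (hσ : Function.Injective σ) {x : 𝓞 F} (hx : x ≠ 0) :
    1 ≤ ∏ j, |σ j (x : F)| := by
  rw [prod_abs_realEmbeddings_eq_abs_norm hd hσ, ← Algebra.coe_norm_int]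
  have : Algebra.norm ℤ x ≠ 0 := Algebra.norm_ne_zero_iff.2 hx
  exact_mod_cast Int.one_le_abs this

theorem prod_abs_realEmbeddings_unit (hd : d = Module.finrank ℚ F)
    (hσ : Function.Injective σ) (ε : (𝓞 F)ˣ) :
    ∏ j, |σ j ((ε : 𝓞 F) : F)| = 1 := by
  rw [prod_abs_realEmbeddings_eq_abs_norm hd hσ]
  have := NumberField.isUnit_iff_norm.1 ε.isUnit
  rw [RingOfIntegers.coe_norm] at this
  exact_mod_cast this

/-- Integers of `F` are separated by the integer parts of any translate of their conjugates. -/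
theorem eq_of_floor_realEmbeddings_sub_eq (hd : d = Module.finrank ℚ F)
    (hσ : Function.Injective σ) (t : Fin d → ℝ) {x y : 𝓞 F}
    (h : ∀ j, ⌊σ j (x : F) - t j⌋ = ⌊σ j (y : F) - t j⌋) : x = y := by
  by_contra hxy
  have h1 := one_le_prod_abs_realEmbeddings hd hσ (sub_ne_zero.2 hxy)
  have hlt : ∀ j, |σ j ((x - y : 𝓞 F) : F)| < 1 := fun j => by
    simpa using Int.abs_sub_lt_one_of_floor_eq_floor (h j)
  have hd0 : 0 < d := hd ▸ Module.finrank_pos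
  have : ∏ j, |σ j ((x - y : 𝓞 F) : F)| < ∏ _j : Fin d, (1 : ℝ) := by
    refine Finset.prod_lt_prod_of_nonempty (fun j _ => ?_) (fun j _ => hlt j)
      ⟨⟨0, hd0⟩, Finset.mem_univ _⟩
    refine abs_pos.2 ((map_ne_zero (σ j)).2 ?_)
    simpa [sub_eq_zero] using hxy
  simp only [Finset.prod_const_one] at this
  linarith

end Embeddings

/-- Let `F` be a totally real number field of degree `d`, with distinct real embeddings
`σ₁, …, σ_d`, let `z₁, …, z_d ∈ ℍ` and let `k₁, …, k_d` be positive integers. For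
`ε ∈ (𝓞 F)ˣ` and `α ∈ 𝓞 F`, let `w (ε, α) j ∈ ℍ` be the point
`σ_j(ε)²·z_j + σ_j(ε)·σ_j(α)`. Then the family
`(ε, α) ↦ ∏_j cosh(d_ℍ(z_j, w (ε, α) j)/2)^{−2k_j}` is summable. -/
theorem summable_cusp_stabilizer (F : Type) [Field F] [NumberField F]
    (htr : ∀ v : InfinitePlace F, v.IsReal)
    (d : ℕ) (hd : d = Module.finrank ℚ F)
    (σ : Fin d → (F →+* ℝ)) (hσ : Function.Injective σ)
    (z : Fin d → ℍ) (k : Fin d → ℕ) (hk : ∀ j, 1 ≤ k j)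
    (w : (𝓞 F)ˣ × 𝓞 F → Fin d → ℍ)
    (hw : ∀ (ε : (𝓞 F)ˣ) (α : 𝓞 F) (j : Fin d),
      (w (ε, α) j : ℂ) =
        ((σ j ((ε : 𝓞 F) : F) : ℝ) : ℂ) ^ 2 * (z j : ℂ) +
          ((σ j ((ε : 𝓞 F) : F) : ℝ) : ℂ) * ((σ j ((α : F)) : ℝ) : ℂ)) :
    Summable fun p : (𝓞 F)ˣ × 𝓞 F =>
      ∏ j : Fin d, (Real.cosh (dist (z j) (w p j) / 2)) ^ (-(2 * (k j : ℤ))) := by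
  have hε : ∀ (ε : (𝓞 F)ˣ) j, σ j ((ε : 𝓞 F) : F) ≠ 0 := fun ε j =>
    (map_ne_zero (σ j)).2 (by simp)
  choose C hC using fun j => exists_inv_quadratic_le (z j).im_pos
  let t : (𝓞 F)ˣ → Fin d → ℝ := fun ε j =>
    (z j).re * ((σ j ((ε : 𝓞 F) : F))⁻¹ - σ j ((ε : 𝓞 F) : F))
  let φ : (𝓞 F)ˣ × 𝓞 F → Fin d → ℤ × ℤ := fun p j =>
    (⌊σ j ((p.1 : 𝓞 F) : F)⌋, ⌊σ j (p.2 : F) - t p.1 j⌋)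
  have hφ : Function.Injective φ := by
    rintro ⟨ε, α⟩ ⟨ε', α'⟩ h
    have h1 : ε = ε' := Units.ext <| eq_of_floor_realEmbeddings_sub_eq hd hσ 0 fun j => by
      simpa using congrArg Prod.fst (congrFun h j)
    subst h1
    have h2 : α = α' := eq_of_floor_realEmbeddings_sub_eq hd hσ (t ε) fun j =>
      congrArg Prod.snd (congrFun h j)
    rw [h2]
  let G : ℤ × ℤ → ℝ := fun q =>
    (1 + |(q.1 : ℝ)|) ^ (-(3 / 2) : ℝ) * (1 + |(q.2 : ℝ)|) ^ (-(5 / 4) : ℝ)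
  have hG : Summable G :=
    (summable_int_one_add_abs_rpow (by norm_num)).mul_of_nonneg
      (summable_int_one_add_abs_rpow (by norm_num)) (fun _ => by positivity)
      (fun _ => by positivity)
  have hsum := ((summable_fin_prod_of_nonneg hG (fun _ => by positivity) d).comp_injective
    hφ).mul_left (∏ j, C j)
  refine hsum.of_nonneg_of_le (fun p => Finset.prod_nonneg fun j _ => by positivity) ?_
  rintro ⟨ε, α⟩
  calc ∏ j, Real.cosh (dist (z j) (w (ε, α) j) / 2) ^ (-(2 * (k j : ℤ)))
      ≤ ∏ j, C j * (|σ j ((ε : 𝓞 F) : F)| ^ (3 / 4 : ℝ) * G (φ (ε, α) j)) := by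
        refine Finset.prod_le_prod (fun j _ => by positivity) fun j _ => ?_
        refine le_trans ?_ (hC j _ _ (hε ε j))
        rw [← cosh_half_dist_sq_of_coe_eq (hε ε j) (hw ε α j), zpow_neg]
        refine inv_anti₀ (by positivity) ?_
        have := hk j
        exact_mod_cast pow_le_pow_right₀ (Real.one_le_cosh _) (by omega : 2 ≤ 2 * k j)
    _ = _ := by
        rw [Finset.prod_mul_distrib, Finset.prod_mul_distrib,
          Real.finsetProd_rpow _ _ (fun j _ => abs_nonneg _),
          prod_abs_realEmbeddings_unit hd hσ, Real.one_rpow, one_mul]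
        rfl
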